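/- For every finite strategic game H, taking beliefs to be joint mixed strategies of the opponents: G_{CK(br^g)} = G_{CB(br^g)} ⊆ T_{msd^l}^∞. That is, common knowledge (equivalently, truth and common belief) of br^g-rationality with respect to mixed-strategy beliefs implies that players choose only strategies that survive the iterated elimination of strategies strictly dominated by a mixed strategy within the current restriction. -/

import Mathlib

universe u

/-- The α-th transfinite iterate of an operator `T` on a complete lattice,
starting at the largest element `⊤`: `T^0 = ⊤`, `T^(α+1) = T (T^α)`,
and `T^β = ⋂_{α<β} T^α` for limit ordinals `β`. -/
noncomputable def iterOp {D : Type u} [CompleteLattice D] (T : D → D) (α : Ordinal.{u}) : D :=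
  Ordinal.limitRecOn α ⊤ (fun _ x => T x)
    (fun β _ IH => ⨅ γ : {γ : Ordinal // γ < β}, IH γ.1 γ.2)

/-- The closure ordinal of `T`: the least `α` with `T^(α+1) = T^α`. -/
noncomputable def closureOrd {D : Type u} [CompleteLattice D] (T : D → D) : Ordinal.{u} :=
  sInf {α : Ordinal | iterOp T (α + 1) = iterOp T α}

/-- The outcome `T^∞` of iterating `T`: the iterate at the closure ordinal. -/
noncomputable def outcomeOp {D : Type u} [CompleteLattice D] (T : D → D) : D :=
  iterOp T (closureOrd T)

/-- Expected payoff of player `i` when playing the mixed strategy `m` against the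
joint strategy of the opponents determined by the profile `t`. -/
noncomputable def mixedPayoff {ι : Type*} [DecidableEq ι] {T : ι → Type*}
    [∀ j, Fintype (T j)] (p : ∀ i : ι, (∀ j, T j) → ℝ)
    (i : ι) (m : T i → ℝ) (t : ∀ j, T j) : ℝ :=
  ∑ x : T i, m x * p i (Function.update t i x)

/-- `msd^l(s, G)`: `s` is not strictly dominated on `G` by any mixed strategy of
player `i` with support contained in `G i`. -/
def msdL {ι : Type*} [DecidableEq ι] {T : ι → Type*} [∀ j, Fintype (T j)]
    (p : ∀ i : ι, (∀ j, T j) → ℝ) (i : ι) (s : T i) (G : ∀ j, Set (T j)) : Prop :=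
  ¬ ∃ m : T i → ℝ, (∀ x, 0 ≤ m x) ∧ (∑ x : T i, m x) = 1 ∧
    (∀ x, m x ≠ 0 → x ∈ G i) ∧
    ∀ t : ∀ j, T j, (∀ j, j ≠ i → t j ∈ G j) →
      mixedPayoff p i m t > p i (Function.update t i s)

/-- Expected payoff of the pure strategy `s` of player `i` against a joint mixed
strategy `m` of the opponents (each `m j` is a distribution; coordinate `i` is
overwritten, so `m i` is irrelevant beyond being a distribution). -/
noncomputable def jmPayoff {ι : Type*} [Fintype ι] [DecidableEq ι] {T : ι → Type*}
    [∀ j, Fintype (T j)] (p : ∀ i : ι, (∀ j, T j) → ℝ)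
    (i : ι) (m : ∀ j, T j → ℝ) (s : T i) : ℝ :=
  ∑ t : ∀ j, T j, (∏ j, m j (t j)) * p i (Function.update t i s)

/-- `br^g(s, G)` with mixed-strategy beliefs: `s` is a best response among all of
`T i` to some joint mixed strategy of the opponents with supports in `G`. -/
def brMixedG {ι : Type*} [Fintype ι] [DecidableEq ι] {T : ι → Type*} [∀ j, Fintype (T j)]
    (p : ∀ i : ι, (∀ j, T j) → ℝ) (i : ι) (s : T i) (G : ∀ j, Set (T j)) : Prop :=
  ∃ m : ∀ j, T j → ℝ,
    (∀ j, (∀ x, 0 ≤ m j x) ∧ (∑ x : T j, m j x) = 1 ∧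
      (j ≠ i → ∀ x, m j x ≠ 0 → x ∈ G j)) ∧
    ∀ s' : T i, jmPayoff p i m s ≥ jmPayoff p i m s'

/-- The operator `T_φ` on restrictions: it removes from each component `G i` the
strategies `s` for which `φ i s G` fails. -/
def TOp {ι : Type*} {T : ι → Type*} (φ : ∀ i : ι, T i → (∀ j, Set (T j)) → Prop)
    (G : ∀ j, Set (T j)) : ∀ j, Set (T j) :=
  fun i => {s ∈ G i | φ i s G}

/-- A belief correspondence: nonempty values, and `ω' ∈ P(ω)` implies `P(ω') = P(ω)`. -/
def BeliefCorr {Ω : Type*} (P : Ω → Set Ω) : Prop :=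
  (∀ ω, (P ω).Nonempty) ∧ ∀ ω ω', ω' ∈ P ω → P ω' = P ω

/-- A knowledge correspondence: a belief correspondence with `ω ∈ P(ω)`. -/
def KnowledgeCorr {Ω : Type*} (P : Ω → Set Ω) : Prop :=
  BeliefCorr P ∧ ∀ ω, ω ∈ P ω

/-- An event `F` is evident if `P_i(ω) ⊆ F` for all `ω ∈ F` and all players `i`. -/
def EvidentEvent {ι Ω : Type*} (P : ι → Ω → Set Ω) (F : Set Ω) : Prop :=
  ∀ ω ∈ F, ∀ i, P i ω ⊆ F

/-- `E` is common knowledge at `ω`: some evident `F` satisfies `ω ∈ F ⊆ E`. -/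
def CommonKnowledgeAt {ι Ω : Type*} (P : ι → Ω → Set Ω) (E : Set Ω) (ω : Ω) : Prop :=
  ∃ F : Set Ω, EvidentEvent P F ∧ ω ∈ F ∧ F ⊆ E

/-- The belief operator `B E = {ω | ∀ i, P_i(ω) ⊆ E}`. -/
def beliefOp {ι Ω : Type*} (P : ι → Ω → Set Ω) (E : Set Ω) : Set Ω :=
  {ω | ∀ i, P i ω ⊆ E}

/-- `E` is common belief at `ω`: some evident `F` satisfies `ω ∈ F ⊆ B E`. -/
def CommonBeliefAt {ι Ω : Type*} (P : ι → Ω → Set Ω) (E : Set Ω) (ω : Ω) : Prop :=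
  ∃ F : Set Ω, EvidentEvent P F ∧ ω ∈ F ∧ F ⊆ beliefOp P E

/-- The restriction `G_E` determined by an event `E`: its `i`-th component is
`{s_i(ω') | ω' ∈ E}`. -/
def restrOf {ι Ω : Type*} {T : ι → Type*} (σ : ∀ i : ι, Ω → T i) (E : Set Ω) :
    ∀ i, Set (T i) :=
  fun i => σ i '' E

/-- `RAT(φ̄)`: the set of states at which each player `i` is `φ_i`-rational, i.e.
`φ_i(s_i(ω), G_{P_i(ω)})` holds. -/
def RATset {ι Ω : Type*} {T : ι → Type*} (φ : ∀ i : ι, T i → (∀ j, Set (T j)) → Prop)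
    (σ : ∀ i : ι, Ω → T i) (P : ι → Ω → Set Ω) : Set Ω :=
  {ω | ∀ i, φ i (σ i ω) (restrOf σ (P i ω))}

/-- `CK(φ̄)`: states at which, for some knowledge correspondences, `RAT(φ̄)` is
common knowledge. -/
def CKset {ι Ω : Type*} {T : ι → Type*} (φ : ∀ i : ι, T i → (∀ j, Set (T j)) → Prop)
    (σ : ∀ i : ι, Ω → T i) : Set Ω :=
  {ω | ∃ P : ι → Ω → Set Ω, (∀ i, KnowledgeCorr (P i)) ∧
        CommonKnowledgeAt P (RATset φ σ P) ω}

/-- `CB(φ̄)`: states `ω` at which, for some belief correspondences, `ω ∈ RAT(φ̄)`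
and `RAT(φ̄)` is common belief at `ω`. -/
def CBset {ι Ω : Type*} {T : ι → Type*} (φ : ∀ i : ι, T i → (∀ j, Set (T j)) → Prop)
    (σ : ∀ i : ι, Ω → T i) : Set Ω :=
  {ω | ∃ P : ι → Ω → Set Ω, (∀ i, BeliefCorr (P i)) ∧
        ω ∈ RATset φ σ P ∧ CommonBeliefAt P (RATset φ σ P) ω}

theorem brMixedG_mono {ι : Type*} [Fintype ι] [DecidableEq ι] {T : ι → Type*}
    [∀ j, Fintype (T j)] {p : ∀ i : ι, (∀ j, T j) → ℝ} {i : ι} {s : T i}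
    {G R : ∀ j, Set (T j)} (hGR : G ≤ R) (h : brMixedG p i s G) : brMixedG p i s R := by
  obtain ⟨m, hm, hs⟩ := h
  exact ⟨m, fun j => ⟨(hm j).1, (hm j).2.1, fun hj x hx => hGR j ((hm j).2.2 hj x hx)⟩, hs⟩

/-- Against a joint mixed strategy, the payoff of a mixed strategy is the average of the payoffs
of the pure strategies it mixes. -/
theorem sum_prod_mul_mixedPayoff {ι : Type*} [Fintype ι] [DecidableEq ι] {T : ι → Type*}
    [∀ j, Fintype (T j)] (p : ∀ i : ι, (∀ j, T j) → ℝ) (i : ι) (μ : ∀ j, T j → ℝ)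
    (m : T i → ℝ) :
    ∑ t : ∀ j, T j, (∏ j, μ j (t j)) * mixedPayoff p i m t =
      ∑ x : T i, m x * jmPayoff p i μ x := by
  simp only [mixedPayoff, jmPayoff, Finset.mul_sum]
  rw [Finset.sum_comm]
  exact Finset.sum_congr rfl fun x _ => Finset.sum_congr rfl fun t _ => by ring

/-- A best response to a joint mixed strategy supported in `G` is not strictly dominated by a
mixed strategy on `G`. -/
theorem msdL_of_brMixedG {ι : Type*} [Fintype ι] [DecidableEq ι] {T : ι → Type*}
    [∀ j, Fintype (T j)] {p : ∀ i : ι, (∀ j, T j) → ℝ} {i : ι} {s : T i}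
    {G : ∀ j, Set (T j)} (h : brMixedG p i s G) : msdL p i s G := by
  obtain ⟨μ, hμ, hs⟩ := h
  rintro ⟨m, hm0, hm1, -, hdom⟩
  have hle : ∑ t : ∀ j, T j, (∏ j, μ j (t j)) * mixedPayoff p i m t ≤ jmPayoff p i μ s := by
    rw [sum_prod_mul_mixedPayoff]
    calc ∑ x : T i, m x * jmPayoff p i μ x ≤ ∑ x : T i, m x * jmPayoff p i μ s :=
          Finset.sum_le_sum fun x _ => mul_le_mul_of_nonneg_left (hs x) (hm0 x)
      _ = jmPayoff p i μ s := by rw [← Finset.sum_mul, hm1, one_mul]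
  refine hle.not_gt ?_
  have hw0 : ∀ t : ∀ j, T j, 0 ≤ ∏ j, μ j (t j) :=
    fun t => Finset.prod_nonneg fun j _ => (hμ j).1 _
  have hw1 : ∑ t : ∀ j, T j, ∏ j, μ j (t j) = 1 := by
    rw [← Fintype.prod_sum]
    exact Finset.prod_eq_one fun j _ => (hμ j).2.1
  have hlt : ∀ t : ∀ j, T j, ∏ j, μ j (t j) ≠ 0 →
      p i (Function.update t i s) < mixedPayoff p i m t := fun t ht =>
    hdom t fun j hj => (hμ j).2.2 hj _ (Finset.prod_ne_zero_iff.mp ht j (Finset.mem_univ j))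
  obtain ⟨t, -, ht⟩ : ∃ t ∈ (Finset.univ : Finset (∀ j, T j)), ∏ j, μ j (t j) ≠ 0 :=
    Finset.exists_ne_zero_of_sum_ne_zero (by rw [hw1]; exact one_ne_zero)
  refine Finset.sum_lt_sum (fun t _ => ?_) ⟨t, Finset.mem_univ t, ?_⟩
  · by_cases h0 : ∏ j, μ j (t j) = 0
    · simp [h0]
    · exact mul_le_mul_of_nonneg_left (hlt t h0).le (hw0 t)
  · exact mul_lt_mul_of_pos_left (hlt t ht) ((hw0 t).lt_of_ne' ht)

theorem le_iterOp {D : Type u} [CompleteLattice D] {T : D → D} {G : D}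
    (h : ∀ R, G ≤ R → G ≤ T R) (α : Ordinal.{u}) : G ≤ iterOp T α := by
  induction α using Ordinal.limitRecOn with
  | zero => simp [iterOp]
  | add_one α ih =>
    have := h _ ih
    simpa [iterOp] using this
  | limit α hα ih =>
    rw [iterOp, Ordinal.limitRecOn_limit _ _ _ _ hα]
    exact le_iInf fun γ => ih γ.1 γ.2

/-- A restriction all of whose strategies are best responses to it survives the iterated
elimination of strategies strictly dominated by a mixed strategy. -/
theorem le_outcomeOp_msdL {ι : Type*} [Fintype ι] [DecidableEq ι] {T : ι → Type*}
    [∀ j, Fintype (T j)] {p : ∀ i : ι, (∀ j, T j) → ℝ} {G : ∀ j, Set (T j)}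
    (hG : ∀ j, ∀ s ∈ G j, brMixedG p j s G) : G ≤ outcomeOp (TOp (msdL p)) :=
  le_iterOp (fun _ hR j s hs => ⟨hR j hs, msdL_of_brMixedG (brMixedG_mono hR (hG j s hs))⟩) _

theorem CKset_subset_CBset {ι Ω : Type*} {T : ι → Type*}
    (φ : ∀ i : ι, T i → (∀ j, Set (T j)) → Prop) (σ : ∀ i : ι, Ω → T i) :
    CKset φ σ ⊆ CBset φ σ := by
  rintro ω ⟨P, hP, F, hF, hω, hR⟩
  exact ⟨P, fun i => (hP i).1, hR hω, F, hF, hω, fun ω' h i => (hF ω' h i).trans hR⟩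

/-- For a monotone property, truth and common belief of rationality at a state yields a
restriction that contains the strategies played there and all of whose strategies satisfy the
property on it. -/
theorem exists_restriction_of_mem_CBset {ι Ω : Type*} {T : ι → Type*}
    {φ : ∀ i : ι, T i → (∀ j, Set (T j)) → Prop}
    (hφ : ∀ (i : ι) (s : T i) (G R : ∀ j, Set (T j)), G ≤ R → φ i s G → φ i s R)
    {σ : ∀ i : ι, Ω → T i} {ω : Ω} (hω : ω ∈ CBset φ σ) :
    ∃ G : ∀ j, Set (T j), (∀ j, σ j ω ∈ G j) ∧ ∀ j, ∀ s ∈ G j, φ j s G := by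
  obtain ⟨P, -, hR, F, hF, hωF, hB⟩ := hω
  refine ⟨restrOf σ (F ∩ RATset φ σ P), fun j => ⟨ω, ⟨hωF, hR⟩, rfl⟩, ?_⟩
  rintro j _ ⟨ω', ⟨hF', hR'⟩, rfl⟩
  exact hφ j _ _ _ (fun k => Set.image_mono (Set.subset_inter (hF ω' hF' j) (hB hF' j))) (hR' j)

/-- If every strategy of a restriction with nonempty components satisfies the property on it,
then each of them is played at a state where rationality is common knowledge. -/
theorem exists_mem_CKset {ι Ω : Type*} {T : ι → Type*}
    {φ : ∀ i : ι, T i → (∀ j, Set (T j)) → Prop} (hcard : ∀ j, Nonempty (T j ↪ Ω))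
    {G : ∀ j, Set (T j)} (hne : ∀ j, (G j).Nonempty) (hG : ∀ j, ∀ s ∈ G j, φ j s G)
    {i : ι} {s : T i} (hs : s ∈ G i) :
    ∃ (σ : ∀ j : ι, Ω → T j) (ω : Ω), s = σ i ω ∧ ω ∈ CKset φ σ := by
  have hsurj : ∀ j, ∃ f : Ω → T j, Set.range f = G j := fun j => by
    obtain ⟨e⟩ := hcard j
    have := (hne j).to_subtype
    have hinj : Function.Injective fun x : G j => e x := e.injective.comp Subtype.val_injective
    refine ⟨Subtype.val ∘ Function.invFun fun x : G j => e x, ?_⟩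
    rw [(Function.invFun_surjective hinj).range_comp, Subtype.range_coe]
  choose σ hσ using hsurj
  have hrestr : restrOf σ Set.univ = G := funext fun j => Set.image_univ.trans (hσ j)
  obtain ⟨ω, rfl⟩ : s ∈ Set.range (σ i) := hσ i ▸ hs
  refine ⟨σ, ω, rfl, fun _ _ => Set.univ,
    fun _ => ⟨⟨fun _ => ⟨ω, trivial⟩, fun _ _ _ => rfl⟩, fun _ => trivial⟩,
    Set.univ, fun _ _ _ => subset_rfl, trivial, fun ω' _ j => ?_⟩
  rw [hrestr]
  exact hG j _ (hσ j ▸ Set.mem_range_self ω')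

/-- For finite games, with beliefs being joint mixed strategies of the opponents:
`G_{CK(br^g)} = G_{CB(br^g)} ⊆ T_{msd^l}^∞`. Common knowledge (equivalently, truth
and common belief) of `br^g`-rationality with respect to mixed-strategy beliefs
implies that players choose only strategies surviving the iterated elimination of
strategies strictly dominated by a mixed strategy within the current restriction. -/
theorem GCK_brMixedG_eq_GCB_subset_TmsdL {ι Ω : Type*} [Fintype ι] [Nontrivial ι]
    [DecidableEq ι] {T : ι → Type*} [∀ j, Fintype (T j)] [∀ j, Nonempty (T j)]
    (p : ∀ i : ι, (∀ j, T j) → ℝ)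
    (hcard : ∀ j, Nonempty (T j ↪ Ω)) (i : ι) :
    {s : T i | ∃ (σ : ∀ j : ι, Ω → T j) (ω : Ω), s = σ i ω ∧ ω ∈ CKset (brMixedG p) σ} =
      {s : T i | ∃ (σ : ∀ j : ι, Ω → T j) (ω : Ω), s = σ i ω ∧ ω ∈ CBset (brMixedG p) σ} ∧
    {s : T i | ∃ (σ : ∀ j : ι, Ω → T j) (ω : Ω), s = σ i ω ∧ ω ∈ CKset (brMixedG p) σ} ⊆
      outcomeOp (TOp (msdL p)) i := by
  have hmono : ∀ (i : ι) (s : T i) (G R : ∀ j, Set (T j)), G ≤ R →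
      brMixedG p i s G → brMixedG p i s R := fun _ _ _ _ => brMixedG_mono
  refine ⟨Set.Subset.antisymm ?_ ?_, ?_⟩
  · rintro s ⟨σ, ω, hs, hω⟩
    exact ⟨σ, ω, hs, CKset_subset_CBset _ σ hω⟩
  · rintro _ ⟨σ, ω, rfl, hω⟩
    obtain ⟨G, hmem, hG⟩ := exists_restriction_of_mem_CBset hmono hω
    exact exists_mem_CKset hcard (fun j => ⟨_, hmem j⟩) hG (hmem i)
  · rintro _ ⟨σ, ω, rfl, hω⟩
    obtain ⟨G, hmem, hG⟩ := exists_restriction_of_mem_CBset hmono (CKset_subset_CBset _ σ hω)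
    exact le_outcomeOp_msdL hG i (hmem i)
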